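/- arXiv:1810.00544 — 4 statements merged into one kernel-verified Lean document; each statement's English description precedes it below -/
import Mathlib

section
/- Let G be a group with a finite semigroup-generating set S (with e ∉ S) and a positive weight function π on S. Let Ω ⊆ G be a finite subset with boundary ∂Ω := {g ∈ Ω : ∃ s ∈ S, gs ∉ Ω} and interior Int(Ω) := Ω ∖ ∂Ω, and assume e ∈ Int(Ω). Let Δ be a finite set of words over S such that every element of ∂Ω is represented by some word of Δ whose π-length equals its weighted word norm (a minimal representative), and every word of Δ represents an element of ∂Ω. Then Δ is an essentially geodesic generating set (egg) for (G,S,π). -/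
/-- The `π`-length of a word `w` over the group `G`: the sum of the weights of its letters. -/
noncomputable def wlen {G : Type*} (π : G → ℝ) (w : List G) : ℝ := (w.map π).sum

/-- The weighted word norm of `g` with respect to the generating set `S` and weight `π`:
the infimum of the `π`-lengths of words over `S` evaluating to `g`. -/
noncomputable def wnorm {G : Type*} [Group G] (S : Set G) (π : G → ℝ) (g : G) : ℝ :=
  sInf {r : ℝ | ∃ w : List G, (∀ x ∈ w, x ∈ S) ∧ w.prod = g ∧ wlen π w = r}

/-- A finite set `Δ` of words over `S` is an essentially geodesic generating set (egg)
for `(G,S,π)` if there is a finite set `F` of words over `S` such that every `g ∈ G`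
has a representative word `δ₁⋯δ_n·h` with all `δᵢ ∈ Δ` and `h ∈ F` whose `π`-length
equals `‖g‖_{S,π}`. -/
def IsEgg {G : Type*} [Group G] (S : Set G) (π : G → ℝ) (Δ : Set (List G)) : Prop :=
  Δ.Finite ∧ (∀ w ∈ Δ, ∀ x ∈ w, x ∈ S) ∧
  ∃ F : Set (List G), F.Finite ∧ (∀ w ∈ F, ∀ x ∈ w, x ∈ S) ∧
    ∀ g : G, ∃ (ds : List (List G)) (h : List G),
      (∀ d ∈ ds, d ∈ Δ) ∧ h ∈ F ∧
      (ds.flatten ++ h).prod = g ∧ wlen π (ds.flatten ++ h) = wnorm S π g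

theorem wlen_append {G : Type*} (π : G → ℝ) (u v : List G) :
    wlen π (u ++ v) = wlen π u + wlen π v := by
  simp [wlen]

theorem length_mul_le_wlen {G : Type*} {S : Set G} {π : G → ℝ} {c : ℝ}
    (hc : ∀ s ∈ S, c ≤ π s) (w : List G) (hw : ∀ x ∈ w, x ∈ S) :
    w.length * c ≤ wlen π w := by
  have h := List.card_nsmul_le_sum (w.map π) c (by
    intro y hy
    obtain ⟨x, hx, rfl⟩ := List.mem_map.1 hy
    exact hc x (hw x hx))
  simpa [wlen] using h

theorem wlen_nonneg {G : Type*} {S : Set G} {π : G → ℝ} (hπ : ∀ s ∈ S, 0 < π s)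
    (w : List G) (hw : ∀ x ∈ w, x ∈ S) : 0 ≤ wlen π w := by
  simpa using length_mul_le_wlen (fun s hs => (hπ s hs).le) w hw

theorem wnorm_le_wlen {G : Type*} [Group G] {S : Set G} {π : G → ℝ} (hπ : ∀ s ∈ S, 0 < π s)
    (w : List G) (hw : ∀ x ∈ w, x ∈ S) : wnorm S π w.prod ≤ wlen π w := by
  refine csInf_le ⟨0, ?_⟩ ⟨w, hw, rfl, rfl⟩
  rintro r ⟨u, hu, -, rfl⟩
  exact wlen_nonneg hπ u hu

theorem finite_words_length_le {G : Type*} {S : Set G} (hS : S.Finite) (N : ℕ) :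
    {w : List G | (∀ x ∈ w, x ∈ S) ∧ w.length ≤ N}.Finite := by
  have : Finite S := hS
  refine ((List.finite_length_le S N).image (List.map Subtype.val)).subset ?_
  rintro w ⟨hw, hN⟩
  lift w to List S using hw
  exact ⟨w, by simpa using hN, rfl⟩

theorem exists_pos_le_weight {G : Type*} {S : Set G} (hS : S.Finite) {π : G → ℝ}
    (hπ : ∀ s ∈ S, 0 < π s) : ∃ c : ℝ, 0 < c ∧ ∀ s ∈ S, c ≤ π s := by
  rcases S.eq_empty_or_nonempty with rfl | hne
  · exact ⟨1, one_pos, by simp⟩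
  · obtain ⟨s, hs, hmin⟩ := Set.exists_min_image S π hS hne
    exact ⟨π s, hπ s hs, hmin⟩

/-- The infimum defining the weighted word norm is attained. -/
theorem exists_wlen_eq_wnorm {G : Type*} [Group G] {S : Set G} {π : G → ℝ} (hS : S.Finite)
    (hπ : ∀ s ∈ S, 0 < π s) (hgen : ∀ g : G, ∃ w : List G, (∀ x ∈ w, x ∈ S) ∧ w.prod = g)
    (g : G) : ∃ w : List G, (∀ x ∈ w, x ∈ S) ∧ w.prod = g ∧ wlen π w = wnorm S π g := by
  obtain ⟨c, hc, hcS⟩ := exists_pos_le_weight hS hπ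
  obtain ⟨w₀, hw₀, hg₀⟩ := hgen g
  obtain ⟨N, hN⟩ := exists_nat_ge (wlen π w₀ / c)
  rw [div_le_iff₀ hc] at hN
  have hlen₀ : w₀.length ≤ N := by
    have := (length_mul_le_wlen hcS w₀ hw₀).trans hN
    exact_mod_cast le_of_mul_le_mul_right this hc
  obtain ⟨w, ⟨⟨hw, -⟩, hg⟩, hmin⟩ := Set.exists_min_image
    ({w : List G | (∀ x ∈ w, x ∈ S) ∧ w.length ≤ N} ∩ {w | w.prod = g}) (wlen π)
    ((finite_words_length_le hS N).inter_of_left _) ⟨w₀, ⟨hw₀, hlen₀⟩, hg₀⟩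
  refine ⟨w, hw, hg, le_antisymm (le_csInf ⟨_, w, hw, hg, rfl⟩ ?_) ?_⟩
  · rintro r ⟨u, hu, hug, rfl⟩
    by_cases hl : u.length ≤ N
    · exact hmin u ⟨⟨hu, hl⟩, hug⟩
    · have h₁ : (N : ℝ) * c ≤ u.length * c := by
        have : (N : ℝ) ≤ u.length := by exact_mod_cast (not_le.1 hl).le
        gcongr
      exact (hmin w₀ ⟨⟨hw₀, hlen₀⟩, hg₀⟩).trans
        (hN.trans (h₁.trans (length_mul_le_wlen hcS u hu)))
  · rw [← hg]
    exact wnorm_le_wlen hπ w hw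

theorem wlen_eq_wnorm_of_append {G : Type*} [Group G] {S : Set G} {π : G → ℝ} (hS : S.Finite)
    (hπ : ∀ s ∈ S, 0 < π s) (hgen : ∀ g : G, ∃ w : List G, (∀ x ∈ w, x ∈ S) ∧ w.prod = g)
    {u v : List G} (hu : ∀ x ∈ u, x ∈ S) (hv : ∀ x ∈ v, x ∈ S)
    (huv : wlen π (u ++ v) = wnorm S π (u ++ v).prod) :
    wlen π u = wnorm S π u.prod ∧ wlen π v = wnorm S π v.prod := by
  obtain ⟨u', hu', hup, hul⟩ := exists_wlen_eq_wnorm hS hπ hgen u.prod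
  obtain ⟨v', hv', hvp, hvl⟩ := exists_wlen_eq_wnorm hS hπ hgen v.prod
  have h := wnorm_le_wlen hπ (u' ++ v') (fun x hx =>
    (List.mem_append.1 hx).elim (hu' x) (hv' x))
  rw [List.prod_append, hup, hvp, ← List.prod_append, ← huv, wlen_append, wlen_append] at h
  have h₁ := wnorm_le_wlen hπ u hu
  have h₂ := wnorm_le_wlen hπ v hv
  constructor <;> linarith

/-- A path starting inside `Ω` and ending outside it has a prefix ending on the boundary. -/
theorem exists_prefix_mem_boundary {G : Type*} [Group G] {S Ω : Set G} (w : List G) :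
    ∀ a ∈ Ω, (∀ x ∈ w, x ∈ S) → a * w.prod ∉ Ω →
      ∃ u v, w = u ++ v ∧ a * u.prod ∈ {g ∈ Ω | ∃ s ∈ S, g * s ∉ Ω} := by
  induction w with
  | nil => intro a ha _ h; simp [ha] at h
  | cons s w ih =>
    intro a ha hw h
    by_cases hs : a * s ∈ Ω
    · obtain ⟨u, v, rfl, hu⟩ := ih (a * s) hs (fun x hx => hw x (List.mem_cons_of_mem _ hx))
        (by simpa [mul_assoc] using h)
      exact ⟨s :: u, v, rfl, by simpa [mul_assoc] using hu⟩
    · exact ⟨[], s :: w, rfl, by simpa using ⟨ha, s, hw s List.mem_cons_self, hs⟩⟩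

/-- minimal representatives of the boundary of a finite set `Ω` whose
interior contains the identity form an egg. -/
theorem isEgg_of_boundary {G : Type*} [Group G] (S : Set G) (π : G → ℝ)
    (hSfin : S.Finite) (hone : (1 : G) ∉ S)
    (hgen : ∀ g : G, ∃ w : List G, (∀ x ∈ w, x ∈ S) ∧ w.prod = g)
    (hπ : ∀ s ∈ S, 0 < π s)
    (Ω : Set G) (hΩfin : Ω.Finite)
    (hint : (1 : G) ∈ Ω \ {g ∈ Ω | ∃ s ∈ S, g * s ∉ Ω})
    (Δ : Set (List G)) (hΔfin : Δ.Finite)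
    (hΔword : ∀ w ∈ Δ, ∀ x ∈ w, x ∈ S)
    (hΔbd : ∀ w ∈ Δ, w.prod ∈ {g ∈ Ω | ∃ s ∈ S, g * s ∉ Ω})
    (hrep : ∀ g ∈ {g ∈ Ω | ∃ s ∈ S, g * s ∉ Ω},
      ∃ w ∈ Δ, w.prod = g ∧ wlen π w = wnorm S π g) :
    IsEgg S π Δ := by
  choose m hmS hmp hml using exists_wlen_eq_wnorm hSfin hπ hgen
  refine ⟨hΔfin, hΔword, m '' Ω, hΩfin.image m, ?_, fun g => ?_⟩
  · rintro _ ⟨g, -, rfl⟩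
    exact hmS g
  have key : ∀ n : ℕ, ∀ w : List G, w.length = n → (∀ x ∈ w, x ∈ S) →
      wlen π w = wnorm S π w.prod → ∃ (ds : List (List G)) (h : List G),
      (∀ d ∈ ds, d ∈ Δ) ∧ h ∈ m '' Ω ∧
      (ds.flatten ++ h).prod = w.prod ∧ wlen π (ds.flatten ++ h) = wnorm S π w.prod := by
    intro n
    induction n using Nat.strong_induction_on with
    | _ n ih =>
      rintro w rfl hw hmin
      by_cases hwΩ : w.prod ∈ Ω
      · exact ⟨[], m w.prod, by simp, ⟨_, hwΩ, rfl⟩, by simp [hmp], by simp [hml]⟩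
      obtain ⟨u, v, rfl, hu⟩ := exists_prefix_mem_boundary w 1 hint.1 hw (by simpa using hwΩ)
      rw [one_mul] at hu
      have hune : u ≠ [] := by
        rintro rfl
        exact hint.2 hu
      have hvS : ∀ x ∈ v, x ∈ S := fun x hx => hw x (List.mem_append_right _ hx)
      obtain ⟨hul, hvl⟩ := wlen_eq_wnorm_of_append hSfin hπ hgen
        (fun x hx => hw x (List.mem_append_left _ hx)) hvS hmin
      obtain ⟨d, hd, hdp, hdl⟩ := hrep _ hu
      obtain ⟨ds, h, hds, hh, hp, hl⟩ := ih v.length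
        (by simpa using List.length_pos_iff.2 hune) v rfl hvS hvl
      refine ⟨d :: ds, h, by simpa using ⟨hd, hds⟩, hh, ?_, ?_⟩
      · rw [List.flatten_cons, List.append_assoc, List.prod_append, hp, hdp, List.prod_append]
      · rw [List.flatten_cons, List.append_assoc, wlen_append, hl, hdl, ← hmin, wlen_append,
          hul, hvl]
  simpa only [hmp] using key _ (m g) rfl (hmS g) ((hml g).trans (by rw [hmp]))
end

section
/- Let G = G₁ ∗ ⋯ ∗ G_k be the free product of finitely many finite groups, let S = ∪ᵢ (Gᵢ ∖ {e}), and let π : S → ℝ_{>0} be a triangular weight function, i.e. for every i and all s, s' ∈ Gᵢ ∖ {e} with ss' ≠ e, one has π(ss') < π(s) + π(s'). Then a word w = s₁⋯s_n over S is a minimal representative for ‖·‖_{S,π} (i.e. |w|_π = ‖g‖_{S,π} for the element g it represents) if and only if w is freely reduced, i.e. for all 1 ≤ m ≤ n−1 the letters s_m and s_{m+1} belong to different factor groups Gᵢ. -/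
open Monoid

/-- The standard generating set of a free product: the union of the images of the
nontrivial elements of the factors under the canonical embeddings. -/
def freeProdGens {ι : Type*} (G : ι → Type*) [∀ i, Group (G i)] :
    Set (CoprodI G) :=
  {g | ∃ (i : ι) (x : G i), x ≠ 1 ∧ CoprodI.of x = g}

/-- Two elements of a free product lie in different factor groups. -/
def DiffFactor {ι : Type*} (G : ι → Type*) [∀ i, Group (G i)]
    (a b : CoprodI G) : Prop :=
  ∀ i : ι, (∃ x : G i, CoprodI.of x = a) → ¬ (∃ y : G i, CoprodI.of y = b)

open scoped Classical in
/-- Freely reduced words over the standard generators are determined by the element they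
represent. -/
theorem eq_of_isChain_diffFactor {ι : Type*} {G : ι → Type*} [∀ i, Group (G i)]
    {v w : List (CoprodI G)} (hv : ∀ x ∈ v, x ∈ freeProdGens G)
    (hw : ∀ x ∈ w, x ∈ freeProdGens G) (hvr : v.IsChain (DiffFactor G))
    (hwr : w.IsChain (DiffFactor G)) (h : v.prod = w.prod) : v = w := by
  have lift_word : ∀ u : List (CoprodI G), (∀ x ∈ u, x ∈ freeProdGens G) →
      u.IsChain (DiffFactor G) →
      ∃ W : CoprodI.Word G, W.toList.map (fun p => CoprodI.of p.2) = u := by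
    intro u hu hur
    have hl : ∃ l : List (Σ i, G i), (∀ p ∈ l, p.2 ≠ 1) ∧
        l.map (fun p => (CoprodI.of p.2 : CoprodI G)) = u := by
      clear hur
      induction u with
      | nil => exact ⟨[], by simp, rfl⟩
      | cons a u ih =>
        obtain ⟨l, hl, rfl⟩ := ih fun x hx => hu x (List.mem_cons_of_mem _ hx)
        obtain ⟨i, x, hx, rfl⟩ := hu a List.mem_cons_self
        exact ⟨⟨i, x⟩ :: l, List.forall_mem_cons.2 ⟨hx, hl⟩, rfl⟩
    obtain ⟨l, hl, rfl⟩ := hl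
    refine ⟨⟨l, hl, ?_⟩, rfl⟩
    refine ((List.isChain_map _).1 hur).imp ?_
    rintro ⟨i, x⟩ ⟨j, y⟩ hxy (rfl : i = j)
    exact hxy i ⟨x, rfl⟩ ⟨y, rfl⟩
  obtain ⟨V, rfl⟩ := lift_word v hv hvr
  obtain ⟨W, rfl⟩ := lift_word w hw hwr
  rw [CoprodI.Word.equiv.symm.injective (a₁ := V) (a₂ := W) h]

/-- For a triangular positive weight, a word which is not freely reduced can be replaced by a
word with fewer letters and strictly smaller weight. -/
theorem exists_lighter_of_not_isChain {ι : Type*} {G : ι → Type*} [∀ i, Group (G i)]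
    {π : CoprodI G → ℝ} (hπ : ∀ s ∈ freeProdGens G, 0 < π s)
    (htri : ∀ (i : ι) (s s' : G i), s ≠ 1 → s' ≠ 1 → s * s' ≠ 1 →
      π (CoprodI.of (s * s')) < π (CoprodI.of s) + π (CoprodI.of s'))
    {w : List (CoprodI G)} (hw : ∀ x ∈ w, x ∈ freeProdGens G)
    (hwr : ¬ w.IsChain (DiffFactor G)) :
    ∃ v : List (CoprodI G), (∀ x ∈ v, x ∈ freeProdGens G) ∧ v.prod = w.prod ∧
      v.length < w.length ∧ wlen π v < wlen π w := by
  rw [List.isChain_iff_forall_rel_of_append_cons_cons] at hwr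
  push Not at hwr
  obtain ⟨a, b, l₁, l₂, rfl, hab⟩ := hwr
  simp only [DiffFactor, not_forall, not_not] at hab
  obtain ⟨i, ⟨x, rfl⟩, ⟨y, rfl⟩⟩ := hab
  have ne_one : ∀ z : G i, CoprodI.of z ∈ freeProdGens G → z ≠ 1 := by
    rintro z ⟨j, t, ht, htz⟩ rfl
    exact ht (CoprodI.of_injective j (by simpa using htz))
  have hxS := hw (CoprodI.of x) (by simp)
  have hyS := hw (CoprodI.of y) (by simp)
  have hx := ne_one x hxS
  have hy := ne_one y hyS
  by_cases hxy : x * y = 1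
  · refine ⟨l₁ ++ l₂, fun z hz => hw z ?_, ?_, by simp, ?_⟩
    · simp only [List.mem_append, List.mem_cons] at hz ⊢
      tauto
    · rw [List.prod_append, List.prod_append, List.prod_cons, List.prod_cons,
        ← mul_assoc (CoprodI.of x), ← map_mul, hxy, map_one, one_mul]
    · have := hπ _ hxS
      have := hπ _ hyS
      simp only [wlen, List.map_append, List.map_cons, List.sum_append, List.sum_cons]
      linarith
  · refine ⟨l₁ ++ CoprodI.of (x * y) :: l₂, fun z hz => ?_, ?_, by simp, ?_⟩
    · rcases List.mem_append.1 hz with hz | hz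
      · exact hw z (by simp [hz])
      · rcases List.mem_cons.1 hz with rfl | hz
        · exact ⟨i, x * y, hxy, rfl⟩
        · exact hw z (by simp [hz])
    · simp [mul_assoc]
    · have := htri i x y hx hy hxy
      simp only [wlen, List.map_append, List.map_cons, List.sum_append, List.sum_cons]
      linarith

/-- For a triangular positive weight, every word can be freely reduced without increasing its
weight. -/
theorem exists_isChain_wlen_le {ι : Type*} {G : ι → Type*} [∀ i, Group (G i)]
    {π : CoprodI G → ℝ} (hπ : ∀ s ∈ freeProdGens G, 0 < π s)
    (htri : ∀ (i : ι) (s s' : G i), s ≠ 1 → s' ≠ 1 → s * s' ≠ 1 →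
      π (CoprodI.of (s * s')) < π (CoprodI.of s) + π (CoprodI.of s'))
    (w : List (CoprodI G)) (hw : ∀ x ∈ w, x ∈ freeProdGens G) :
    ∃ v : List (CoprodI G), (∀ x ∈ v, x ∈ freeProdGens G) ∧ v.prod = w.prod ∧
      v.IsChain (DiffFactor G) ∧ wlen π v ≤ wlen π w := by
  induction hn : w.length using Nat.strong_induction_on generalizing w with
  | _ n ih =>
    by_cases hwr : w.IsChain (DiffFactor G)
    · exact ⟨w, hw, rfl, hwr, le_rfl⟩
    · obtain ⟨u, hu, hup, hul, huw⟩ := exists_lighter_of_not_isChain hπ htri hw hwr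
      obtain ⟨v, hv, hvp, hvr, hvu⟩ := ih u.length (hn ▸ hul) u hu rfl
      exact ⟨v, hv, hvp.trans hup, hvr, hvu.trans huw.le⟩

/-- in a free product of finitely many finite groups with the standard
generating set `S = ∪ᵢ (Gᵢ ∖ {e})` and a triangular positive weight `π`, a word over
`S` is a minimal representative for `‖·‖_{S,π}` iff it is freely reduced, i.e.
consecutive letters belong to different factor groups. -/
theorem freeProduct_minimal_iff_reduced {ι : Type*} [Fintype ι]
    (G : ι → Type*) [∀ i, Group (G i)] [∀ i, Fintype (G i)]
    (π : CoprodI G → ℝ) (hπ : ∀ s ∈ freeProdGens G, 0 < π s)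
    (htri : ∀ (i : ι) (s s' : G i), s ≠ 1 → s' ≠ 1 → s * s' ≠ 1 →
      π (CoprodI.of (s * s')) < π (CoprodI.of s) + π (CoprodI.of s'))
    (w : List (CoprodI G)) (hw : ∀ x ∈ w, x ∈ freeProdGens G) :
    wlen π w = wnorm (freeProdGens G) π w.prod ↔
      List.Chain' (DiffFactor G) w := by
  constructor
  · intro hmin
    by_contra hwr
    obtain ⟨v, hv, hvp, -, hvw⟩ := exists_lighter_of_not_isChain hπ htri hw hwr
    refine hvw.not_ge (hmin.trans_le (csInf_le ⟨0, ?_⟩ ⟨v, hv, hvp, rfl⟩))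
    rintro _ ⟨u, hu, -, rfl⟩
    refine List.sum_nonneg fun r hr => ?_
    obtain ⟨x, hx, rfl⟩ := List.mem_map.1 hr
    exact (hπ x (hu x hx)).le
  · intro hwr
    symm
    apply IsLeast.csInf_eq
    refine ⟨⟨w, hw, rfl, rfl⟩, ?_⟩
    rintro _ ⟨u, hu, hup, rfl⟩
    obtain ⟨v, hv, hvp, hvr, hvu⟩ := exists_isChain_wlen_le hπ htri u hu
    rwa [eq_of_isChain_diffFactor hv hw hvr hwr (hvp.trans hup)] at hvu
end

section
/- Let G = G₁ ∗ ⋯ ∗ G_k be the free product of finitely many finite groups, let S = ∪ᵢ (Gᵢ ∖ {e}), and let π : S → ℝ_{>0} be a triangular weight function, i.e. for every i and all s, s' ∈ Gᵢ ∖ {e} with ss' ≠ e, one has π(ss') < π(s) + π(s'). Then a finite set Δ of words over S is an essentially geodesic generating set (egg) for (G, S, π) if and only if it is an egg for (G, S, 1), i.e. for the uniform word norm with constant weight 1. -/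
open Monoid

theorem wlen_cons {G : Type*} (π : G → ℝ) (a : G) (l : List G) :
    wlen π (a :: l) = π a + wlen π l := by simp [wlen]

/-- A weight on a free product is triangular if merging two letters of the same factor
strictly decreases the length. -/
def IsTriangular {ι : Type*} {G : ι → Type*} [∀ i, Group (G i)] (π : CoprodI G → ℝ) : Prop :=
  ∀ (i : ι) (s s' : G i), s ≠ 1 → s' ≠ 1 → s * s' ≠ 1 →
    π (CoprodI.of (s * s')) < π (CoprodI.of s) + π (CoprodI.of s')

/-- The letters of a reduced word, as elements of the free product. -/
def Monoid.CoprodI.Word.letters {ι : Type*} {G : ι → Type*} [∀ i, Group (G i)]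
    (w : CoprodI.Word G) : List (CoprodI G) :=
  w.toList.map fun x => CoprodI.of x.2

section

variable {ι : Type*} {G : ι → Type*} [∀ i, Group (G i)]

theorem Monoid.CoprodI.Word.letters_cons {i : ι} (m : G i) (w : CoprodI.Word G)
    (h : w.fstIdx ≠ some i) (h1 : m ≠ 1) :
    (CoprodI.Word.cons m w h h1).letters = CoprodI.of m :: w.letters := rfl

theorem Monoid.CoprodI.Word.mem_freeProdGens_of_mem_letters (w : CoprodI.Word G)
    {x : CoprodI G} (hx : x ∈ w.letters) : x ∈ freeProdGens G := by
  obtain ⟨y, hy, rfl⟩ := List.mem_map.1 hx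
  exact ⟨y.1, y.2, w.ne_one y hy, rfl⟩

theorem Monoid.CoprodI.Word.prod_injective :
    Function.Injective (CoprodI.Word.prod : CoprodI.Word G → CoprodI G) := by
  classical
  exact (CoprodI.Word.equiv (M := G)).symm.injective

/-- Left multiplication of a reduced word by a letter yields a reduced word which is either
the concatenation or strictly shorter than it. -/
theorem exists_word_prod_eq_of_mul {π : CoprodI G → ℝ} (hπ : ∀ s ∈ freeProdGens G, 0 < π s)
    (htri : IsTriangular π) {i : ι} (m : G i) (hm : m ≠ 1) (w : CoprodI.Word G) :
    ∃ v : CoprodI.Word G, v.prod = CoprodI.of m * w.prod ∧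
      (v.letters = CoprodI.of m :: w.letters ∨
        wlen π v.letters < π (CoprodI.of m) + wlen π w.letters) := by
  classical
  by_cases hi : w.fstIdx = some i
  · induction w using CoprodI.Word.consRecOn with
    | empty => simp [CoprodI.Word.fstIdx, CoprodI.Word.empty] at hi
    | cons j n w h1 h2 _ =>
      obtain rfl : j = i := by simpa using hi
      simp only [CoprodI.Word.letters_cons, CoprodI.Word.prod_cons, wlen_cons, ← mul_assoc,
        ← map_mul]
      by_cases hmn : m * n = 1
      · refine ⟨w, by simp [hmn], Or.inr ?_⟩
        linarith [hπ _ ⟨j, m, hm, rfl⟩, hπ _ ⟨j, n, h2, rfl⟩]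
      · refine ⟨CoprodI.Word.cons (m * n) w h1 hmn, CoprodI.Word.prod_cons _ _ _ _ _, Or.inr ?_⟩
        rw [CoprodI.Word.letters_cons, wlen_cons]
        linarith [htri j m n hm h2 hmn]
  · exact ⟨CoprodI.Word.cons m w hi hm, CoprodI.Word.prod_cons _ _ _ _ _, Or.inl rfl⟩

theorem exists_word_prod_eq {π : CoprodI G → ℝ} (hπ : ∀ s ∈ freeProdGens G, 0 < π s)
    (htri : IsTriangular π) (l : List (CoprodI G)) (hl : ∀ x ∈ l, x ∈ freeProdGens G) :
    ∃ w : CoprodI.Word G, w.prod = l.prod ∧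
      (l = w.letters ∨ wlen π w.letters < wlen π l) := by
  induction l with
  | nil => exact ⟨CoprodI.Word.empty, rfl, Or.inl rfl⟩
  | cons a t ih =>
    obtain ⟨w, hw, hwt⟩ := ih fun x hx => hl x (List.mem_cons_of_mem _ hx)
    obtain ⟨i, m, hm, rfl⟩ := hl a List.mem_cons_self
    obtain ⟨v, hv, hvw⟩ := exists_word_prod_eq_of_mul hπ htri m hm w
    refine ⟨v, by rw [hv, hw, List.prod_cons], ?_⟩
    rw [wlen_cons]
    rcases hwt with rfl | hwt <;> rcases hvw with hvw | hvw
    · exact Or.inl hvw.symm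
    · exact Or.inr hvw
    · right
      rw [hvw, wlen_cons]
      linarith
    · right
      linarith

theorem eq_letters_or_wlen_lt {π : CoprodI G → ℝ} (hπ : ∀ s ∈ freeProdGens G, 0 < π s)
    (htri : IsTriangular π) (w : CoprodI.Word G) {l : List (CoprodI G)}
    (hl : ∀ x ∈ l, x ∈ freeProdGens G) (hlw : l.prod = w.prod) :
    l = w.letters ∨ wlen π w.letters < wlen π l := by
  obtain ⟨v, hv, h⟩ := exists_word_prod_eq hπ htri l hl
  rwa [CoprodI.Word.prod_injective (hv.trans hlw)] at h

theorem wnorm_word_prod {π : CoprodI G → ℝ} (hπ : ∀ s ∈ freeProdGens G, 0 < π s)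
    (htri : IsTriangular π) (w : CoprodI.Word G) :
    wnorm (freeProdGens G) π w.prod = wlen π w.letters := by
  refine IsLeast.csInf_eq ⟨⟨w.letters, fun _ => w.mem_freeProdGens_of_mem_letters, rfl, rfl⟩, ?_⟩
  rintro _ ⟨l, hl, hlw, rfl⟩
  rcases eq_letters_or_wlen_lt hπ htri w hl hlw with rfl | h
  · exact le_rfl
  · exact h.le

/-- For a triangular weight, the reduced word is the unique minimal representative. -/
theorem wlen_eq_wnorm_iff {π : CoprodI G → ℝ} (hπ : ∀ s ∈ freeProdGens G, 0 < π s)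
    (htri : IsTriangular π) (w : CoprodI.Word G) {l : List (CoprodI G)}
    (hl : ∀ x ∈ l, x ∈ freeProdGens G) (hlw : l.prod = w.prod) :
    wlen π l = wnorm (freeProdGens G) π w.prod ↔ l = w.letters := by
  rw [wnorm_word_prod hπ htri]
  refine ⟨fun h => ?_, fun h => by rw [h]⟩
  exact (eq_letters_or_wlen_lt hπ htri w hl hlw).resolve_right h.not_gt

theorem IsEgg.of_isTriangular {π ρ : CoprodI G → ℝ} (hπ : ∀ s ∈ freeProdGens G, 0 < π s)
    (hπtri : IsTriangular π) (hρ : ∀ s ∈ freeProdGens G, 0 < ρ s) (hρtri : IsTriangular ρ)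
    {Δ : Set (List (CoprodI G))} (h : IsEgg (freeProdGens G) π Δ) :
    IsEgg (freeProdGens G) ρ Δ := by
  classical
  obtain ⟨hfin, hΔ, F, hFfin, hF, hrep⟩ := h
  refine ⟨hfin, hΔ, F, hFfin, hF, fun g => ?_⟩
  obtain ⟨ds, f, hds, hf, hprod, hlen⟩ := hrep g
  refine ⟨ds, f, hds, hf, hprod, ?_⟩
  obtain ⟨w, rfl⟩ := (CoprodI.Word.equiv (M := G)).symm.surjective g
  have hmem : ∀ x ∈ ds.flatten ++ f, x ∈ freeProdGens G := by
    intro x hx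
    rcases List.mem_append.1 hx with hx | hx
    · obtain ⟨d, hd, hxd⟩ := List.mem_flatten.1 hx
      exact hΔ d (hds d hd) x hxd
    · exact hF f hf x hx
  exact (wlen_eq_wnorm_iff hρ hρtri w hmem hprod).2
    ((wlen_eq_wnorm_iff hπ hπtri w hmem hprod).1 hlen)

end

/-- in a free product of finitely many finite groups with the standard
generating set `S = ∪ᵢ (Gᵢ ∖ {e})` and a triangular positive weight `π`, a finite set
of words over `S` is an egg for `(G, S, π)` iff it is an egg for the uniform word norm
(constant weight `1`). -/
theorem freeProduct_isEgg_iff {ι : Type*} [Fintype ι]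
    (G : ι → Type*) [∀ i, Group (G i)] [∀ i, Fintype (G i)]
    (π : CoprodI G → ℝ) (hπ : ∀ s ∈ freeProdGens G, 0 < π s)
    (htri : ∀ (i : ι) (s s' : G i), s ≠ 1 → s' ≠ 1 → s * s' ≠ 1 →
      π (CoprodI.of (s * s')) < π (CoprodI.of s) + π (CoprodI.of s'))
    (Δ : Set (List (CoprodI G))) :
    IsEgg (freeProdGens G) π Δ ↔ IsEgg (freeProdGens G) (fun _ => (1 : ℝ)) Δ := by
  have hone : ∀ s ∈ freeProdGens G, (0 : ℝ) < (fun _ => (1 : ℝ)) s := fun _ _ => one_pos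
  have honetri : IsTriangular (G := G) (fun _ => (1 : ℝ)) := fun _ _ _ _ _ _ => by norm_num
  exact ⟨IsEgg.of_isTriangular hπ htri hone honetri, IsEgg.of_isTriangular hone honetri hπ htri⟩
end

section
/- Let G be a group with a finite semigroup-generating set S and positive weight π, let d ≥ 2 be an integer, K a nonempty finite set, η ∈ (0,1) and c₀ > 0. Assume there is an injective map Φ : G → K × G^d such that for every g ∈ G, writing Φ(g) = (k, g₁, …, g_d), one has Σᵢ ‖gᵢ‖_{S,π} ≤ η·‖g‖_{S,π} + c₀. Then there exist a constant c₁ > 0 and an injective map Ψ : G → K^{d+1} × G^{d²} such that for every g ∈ G, writing Ψ(g) = (k₁, …, k_{d+1}, h₁, …, h_{d²}), one has Σⱼ ‖hⱼ‖_{S,π} ≤ η²·‖g‖_{S,π} + c₁ (the contraction hypothesis iterates from parameter (η, c₀, d, K) to (η², c₁, d², K^{d+1})). -/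
/-- the contraction hypothesis iterates: from an injective
`Φ : G → K × G^d` with `Σᵢ ‖gᵢ‖ ≤ η‖g‖ + c₀` one obtains an injective
`Ψ : G → K^{d+1} × G^{d²}` with `Σⱼ ‖hⱼ‖ ≤ η²‖g‖ + c₁` for some constant `c₁ > 0`. -/
theorem contraction_iterates {G : Type*} [Group G] (S : Set G) (π : G → ℝ)
    (hSfin : S.Finite) (hone : (1 : G) ∉ S)
    (hgen : ∀ g : G, ∃ w : List G, (∀ x ∈ w, x ∈ S) ∧ w.prod = g)
    (hπ : ∀ s ∈ S, 0 < π s)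
    (d : ℕ) (hd : 2 ≤ d)
    (K : Type*) [Fintype K] [Nonempty K]
    (η : ℝ) (hη : η ∈ Set.Ioo (0 : ℝ) 1) (c₀ : ℝ) (hc₀ : 0 < c₀)
    (Φ : G → K × (Fin d → G)) (hΦinj : Function.Injective Φ)
    (hΦ : ∀ g : G, ∑ i : Fin d, wnorm S π ((Φ g).2 i) ≤ η * wnorm S π g + c₀) :
    ∃ (c₁ : ℝ), 0 < c₁ ∧
      ∃ Ψ : G → (Fin (d + 1) → K) × (Fin (d ^ 2) → G), Function.Injective Ψ ∧
        ∀ g : G, ∑ j : Fin (d ^ 2), wnorm S π ((Ψ g).2 j) ≤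
          η ^ 2 * wnorm S π g + c₁ := by
  let e : Fin (d ^ 2) ≃ Fin d × Fin d := (finCongr (sq d)).trans finProdFinEquiv.symm
  have hη0 : 0 < η := hη.1
  refine ⟨η * c₀ + d * c₀, by positivity,
    fun g => (Fin.cons (Φ g).1 fun i => (Φ ((Φ g).2 i)).1,
      fun j => (Φ ((Φ g).2 (e j).1)).2 (e j).2), ?_, fun g => ?_⟩
  · intro g g' h
    obtain ⟨hk, hw⟩ := Prod.ext_iff.mp h
    obtain ⟨hk₀, hks⟩ := Fin.cons_inj (α := fun _ => K) |>.mp hk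
    refine hΦinj (Prod.ext hk₀ (funext fun i => hΦinj (Prod.ext (congrFun hks i) ?_)))
    funext j
    simpa using congrFun hw (e.symm (i, j))
  · calc ∑ j, wnorm S π ((Φ ((Φ g).2 (e j).1)).2 (e j).2)
        = ∑ p : Fin d × Fin d, wnorm S π ((Φ ((Φ g).2 p.1)).2 p.2) :=
          e.sum_comp fun p => wnorm S π ((Φ ((Φ g).2 p.1)).2 p.2)
      _ = ∑ i, ∑ j, wnorm S π ((Φ ((Φ g).2 i)).2 j) := Fintype.sum_prod_type _
      _ ≤ ∑ i, (η * wnorm S π ((Φ g).2 i) + c₀) := Finset.sum_le_sum fun i _ => hΦ _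
      _ = η * ∑ i, wnorm S π ((Φ g).2 i) + d * c₀ := by
          simp [Finset.sum_add_distrib, Finset.mul_sum]
      _ ≤ η * (η * wnorm S π g + c₀) + d * c₀ := by gcongr; exact hΦ g
      _ = η ^ 2 * wnorm S π g + (η * c₀ + d * c₀) := by ring
end
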